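/- If f is in the class T of typically real functions on the unit disk with Taylor expansion f(z) = z + ∑_{k≥2} a_k z^k (so that all coefficients a_k are real), then −9 ≤ T_2(2) = a_2² − a_3² ≤ 5/4, and both bounds are sharp within T. -/

import Mathlib

/-- `f` is a typically real function on the unit disk with (real) Taylor
coefficients `a`: it is analytic on the disk, normalized by `a 0 = 0`,
`a 1 = 1`, has power series expansion `f z = ∑ a n * z ^ n` on the disk,
and satisfies `(Im z) * (Im (f z)) ≥ 0` there. -/
def IsTypicallyReal (f : ℂ → ℂ) (a : ℕ → ℝ) : Prop :=
  DifferentiableOn ℂ f (Metric.ball (0:ℂ) 1) ∧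
  a 0 = 0 ∧ a 1 = 1 ∧
  (∀ z ∈ Metric.ball (0:ℂ) 1, HasSum (fun n : ℕ => (a n : ℂ) * z ^ n) (f z)) ∧
  ∀ z ∈ Metric.ball (0:ℂ) 1, 0 ≤ z.im * (f z).im

open MeasureTheory intervalIntegral in
lemma aux_cos (m : ℤ) : ∫ x in (0:ℝ)..(2 * Real.pi), Real.cos (m * x) = if m = 0 then 2 * Real.pi else 0 := by
  split_ifs with h
  · subst h; simp
  · have hm : (m : ℝ) ≠ 0 := by exact_mod_cast h
    rw [intervalIntegral.integral_comp_mul_left (fun x => Real.cos x) hm, integral_cos]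
    have : Real.sin ((m:ℝ) * (2 * Real.pi)) = 0 := by
      have := Real.sin_int_mul_pi (2 * m)
      push_cast at this
      rw [← this]; ring_nf
    simp [this]

lemma aux_sin (n k : ℕ) (hk : k ≠ 0) :
    ∫ x in (0:ℝ)..(2 * Real.pi), Real.sin (n * x) * Real.sin (k * x) = if n = k then Real.pi else 0 := by
  have h : ∀ x : ℝ, Real.sin (n * x) * Real.sin (k * x) =
      (1/2) * (Real.cos (((n - k : ℤ) : ℝ) * x) - Real.cos (((n + k : ℤ) : ℝ) * x)) := by
    intro x
    push_cast
    rw [sub_mul, add_mul, Real.cos_sub, Real.cos_add]; ring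
  simp_rw [h]
  rw [intervalIntegral.integral_const_mul, intervalIntegral.integral_sub, aux_cos, aux_cos]
  · have h2 : ¬ ((n:ℤ) + k = 0) := by omega
    rw [if_neg h2]
    by_cases hnk : n = k
    · subst hnk; simp
    · have : ¬ ((n:ℤ) - k = 0) := by omega
      rw [if_neg this, if_neg hnk]; simp
  · exact Continuous.intervalIntegrable (by fun_prop) _ _
  · exact Continuous.intervalIntegrable (by fun_prop) _ _

lemma aux_pt (r x : ℝ) (n : ℕ) (a : ℝ) :
    ((a:ℂ) * ((r:ℂ) * Complex.exp (x * Complex.I)) ^ n).im = a * r ^ n * Real.sin (n * x) := by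
  rw [mul_pow, ← Complex.exp_nat_mul]
  have : (n:ℂ) * (x * Complex.I) = ((n * x : ℝ) : ℂ) * Complex.I := by push_cast; ring
  rw [this, ← mul_assoc]
  have h2 : (a:ℂ) * (r:ℂ)^n = ((a * r ^ n : ℝ) : ℂ) := by push_cast; ring
  rw [h2, Complex.im_ofReal_mul, Complex.exp_ofReal_mul_I_im]

lemma aux_mem (r x : ℝ) (h0 : 0 < r) (h1 : r < 1) :
    ((r:ℂ) * Complex.exp (x * Complex.I)) ∈ Metric.ball (0:ℂ) 1 := by
  simp [Complex.norm_exp_ofReal_mul_I, abs_of_pos h0, h1]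

lemma aux_coef (f : ℂ → ℂ) (a : ℕ → ℝ) (hf : IsTypicallyReal f a) (r : ℝ) (h0 : 0 < r) (h1 : r < 1)
    (k : ℕ) (hk : k ≠ 0) :
    ∫ x in (0:ℝ)..(2 * Real.pi), (f (r * Complex.exp (x * Complex.I))).im * Real.sin (k * x)
      = Real.pi * (a k * r ^ k) := by
  obtain ⟨hd, -, -, hs, -⟩ := hf
  have hsum : ∀ x : ℝ, HasSum (fun n : ℕ => a n * r ^ n * Real.sin (n * x) * Real.sin (k * x))
      ((f (r * Complex.exp (x * Complex.I))).im * Real.sin (k * x)) := by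
    intro x
    have := (Complex.hasSum_im (hs _ (aux_mem r x h0 h1))).mul_right (Real.sin (k * x))
    simpa only [aux_pt] using this
  have hsa : Summable (fun n : ℕ => |a n| * r ^ n) := by
    have := (hs (r:ℂ) (by simp [abs_of_pos h0, h1])).summable.norm
    simpa [abs_of_pos h0] using this
  have key : HasSum (fun n : ℕ => ∫ x in (0:ℝ)..(2 * Real.pi), a n * r ^ n * Real.sin (n * x) * Real.sin (k * x))
      (∫ x in (0:ℝ)..(2 * Real.pi), (f (r * Complex.exp (x * Complex.I))).im * Real.sin (k * x)) := by
    apply intervalIntegral.hasSum_integral_of_dominated_convergence (fun n _ => |a n| * r ^ n)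
    · intro n
      exact (Continuous.aestronglyMeasurable (by fun_prop))
    · intro n
      refine Filter.Eventually.of_forall fun x _ => ?_
      rw [Real.norm_eq_abs, abs_mul, abs_mul, abs_mul, abs_of_pos (pow_pos h0 n)]
      have p1 := Real.abs_sin_le_one (n * x)
      have p2 := Real.abs_sin_le_one (k * x)
      have p3 : 0 ≤ |a n| * r ^ n := by positivity
      calc _ ≤ |a n| * r ^ n * 1 * 1 := by gcongr
        _ = _ := by ring
    · exact Filter.Eventually.of_forall fun x _ => hsa
    · simp
    · exact Filter.Eventually.of_forall fun x _ => hsum x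
  have e : (fun n : ℕ => ∫ x in (0:ℝ)..(2 * Real.pi), a n * r ^ n * Real.sin (n * x) * Real.sin (k * x))
      = fun n => if n = k then Real.pi * (a k * r ^ k) else 0 := by
    funext n
    simp_rw [mul_assoc (a n * r ^ n)]
    rw [intervalIntegral.integral_const_mul, aux_sin n k hk]
    split_ifs with h
    · subst h; ring
    · simp
  rw [e] at key
  exact key.unique (hasSum_ite_eq k _)

lemma aux_cont (f : ℂ → ℂ) (a : ℕ → ℝ) (hf : IsTypicallyReal f a) (r : ℝ) (h0 : 0 < r) (h1 : r < 1) :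
    Continuous (fun x : ℝ => (f (r * Complex.exp (x * Complex.I))).im) := by
  refine Complex.continuous_im.comp ?_
  exact hf.1.continuousOn.comp_continuous (by fun_prop) (fun x => aux_mem r x h0 h1)

lemma aux_ineq (f : ℂ → ℂ) (a : ℕ → ℝ) (hf : IsTypicallyReal f a) (r : ℝ) (h0 : 0 < r) (h1 : r < 1)
    (c1 c2 c3 : ℝ) (hp : ∀ x : ℝ, ∃ q : ℝ, 0 ≤ q ∧
      c1 * Real.sin x + c2 * Real.sin (2 * x) + c3 * Real.sin (3 * x) = q * Real.sin x) :
    0 ≤ c1 * r + c2 * (a 2 * r ^ 2) + c3 * (a 3 * r ^ 3) := by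
  have hc := aux_cont f a hf r h0 h1
  have i1 := aux_coef f a hf r h0 h1 1 (by norm_num)
  have i2 := aux_coef f a hf r h0 h1 2 (by norm_num)
  have i3 := aux_coef f a hf r h0 h1 3 (by norm_num)
  have hnn : 0 ≤ ∫ x in (0:ℝ)..(2 * Real.pi),
      (c1 * ((f (r * Complex.exp (x * Complex.I))).im * Real.sin ((1:ℕ) * x))
      + c2 * ((f (r * Complex.exp (x * Complex.I))).im * Real.sin ((2:ℕ) * x))
      + c3 * ((f (r * Complex.exp (x * Complex.I))).im * Real.sin ((3:ℕ) * x))) := by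
    apply intervalIntegral.integral_nonneg (by positivity)
    intro x _
    obtain ⟨q, hq, e⟩ := hp x
    have hpos := hf.2.2.2.2 _ (aux_mem r x h0 h1)
    rw [Complex.im_ofReal_mul, Complex.exp_ofReal_mul_I_im] at hpos
    have h3 : 0 ≤ Real.sin x * (f (r * Complex.exp (x * Complex.I))).im := by
      rw [mul_assoc] at hpos
      exact nonneg_of_mul_nonneg_right hpos h0
    have h4 := mul_nonneg hq h3
    push_cast
    rw [one_mul]
    calc 0 ≤ _ := h4
      _ = (q * Real.sin x) * (f (r * Complex.exp (x * Complex.I))).im := by ring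
      _ = _ := by rw [← e]; ring
  rw [intervalIntegral.integral_add, intervalIntegral.integral_add,
    intervalIntegral.integral_const_mul, intervalIntegral.integral_const_mul,
    intervalIntegral.integral_const_mul, i1, i2, i3, hf.2.2.1] at hnn
  · have : 0 ≤ Real.pi * (c1 * r + c2 * (a 2 * r ^ 2) + c3 * (a 3 * r ^ 3)) := by
      linarith
    exact nonneg_of_mul_nonneg_right this Real.pi_pos
  all_goals exact Continuous.intervalIntegrable (by fun_prop) _ _

lemma aux_ineq1 (f : ℂ → ℂ) (a : ℕ → ℝ) (hf : IsTypicallyReal f a)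
    (c1 c2 c3 : ℝ) (hp : ∀ x : ℝ, ∃ q : ℝ, 0 ≤ q ∧
      c1 * Real.sin x + c2 * Real.sin (2 * x) + c3 * Real.sin (3 * x) = q * Real.sin x) :
    0 ≤ c1 + c2 * a 2 + c3 * a 3 := by
  have hc : Continuous (fun r : ℝ => c1 * r + c2 * (a 2 * r ^ 2) + c3 * (a 3 * r ^ 3)) := by fun_prop
  have ht := (hc.tendsto 1).mono_left (nhdsWithin_le_nhds (s := Set.Iio 1))
  have := ge_of_tendsto ht (b := 0) (by
    filter_upwards [Ioo_mem_nhdsLT (show (0:ℝ) < 1 by norm_num)] with r hr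
    exact aux_ineq f a hf r hr.1 hr.2 c1 c2 c3 hp)
  simpa using this

lemma aux_bounds (f : ℂ → ℂ) (a : ℕ → ℝ) (hf : IsTypicallyReal f a) :
    a 2 ^ 2 ≤ a 3 + 1 ∧ a 3 ≤ 3 := by
  constructor
  · have := aux_ineq1 f a hf (1 + a 2 ^ 2) (-2 * a 2) 1 (fun x =>
      ⟨(2 * Real.cos x - a 2) ^ 2, sq_nonneg _, by
        rw [Real.sin_two_mul, Real.sin_three_mul]
        have := Real.sin_sq_add_cos_sq x
        linear_combination (-4 * Real.sin x) * this⟩)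
    nlinarith
  · have := aux_ineq1 f a hf 3 0 (-1) (fun x =>
      ⟨(2 * Real.sin x) ^ 2, sq_nonneg _, by
        rw [Real.sin_three_mul]; ring⟩)
    linarith

lemma aux_hs {f g : ℕ → ℂ} {b c : ℂ} (h : HasSum g c) (h1 : ∀ n, f n = g n) (h2 : b = c) :
    HasSum f b := by
  rw [funext h1, h2]; exact h

lemma aux_div (z d : ℂ) (h : 0 ≤ z.im * (z * (starRingEnd ℂ) d).im) : 0 ≤ z.im * (z / d).im := by
  have : (z / d).im = (z * (starRingEnd ℂ) d).im / Complex.normSq d := by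
    rw [Complex.div_im, Complex.mul_im]; simp; ring
  rw [this, ← mul_div_assoc]
  exact div_nonneg h (Complex.normSq_nonneg d)

lemma aux_quad (t : ℝ) (z : ℂ) (hz : z ∈ Metric.ball (0:ℂ) 1) :
    0 ≤ z.im * (z / (1 - 2 * t * z + z ^ 2)).im := by
  apply aux_div z
  have h1 : z.re * z.re + z.im * z.im ≤ 1 := by
    rw [← Complex.normSq_apply, Complex.normSq_eq_norm_sq]
    have : ‖z‖ < 1 := by simpa using hz
    nlinarith [norm_nonneg z]
  have : (z * (starRingEnd ℂ) (1 - 2 * t * z + z ^ 2)).im = z.im * (1 - (z.re * z.re + z.im * z.im)) := by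
    simp [pow_two]; ring
  rw [this, ← mul_assoc]
  exact mul_nonneg (mul_self_nonneg _) (by linarith)

lemma aux_ne (w z : ℂ) (hw : ‖w‖ = 1) (hz : z ∈ Metric.ball (0:ℂ) 1) : 1 - w * z ≠ 0 := by
  intro h
  have h1 : w * z = 1 := (sub_eq_zero.mp h).symm
  have h2 := congrArg norm h1
  have : ‖z‖ < 1 := by simpa using hz
  rw [norm_mul, hw, one_mul, norm_one] at h2
  linarith

lemma aux_upper : ∃ (f : ℂ → ℂ) (a : ℕ → ℝ), IsTypicallyReal f a ∧
      a 2 ^ 2 - a 3 ^ 2 = 5 / 4 := by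
  set t : ℝ := Real.sqrt (3/8) with ht
  set s : ℝ := Real.sqrt (5/8) with hs
  have t2 : t ^ 2 = 3/8 := Real.sq_sqrt (by norm_num)
  have s2 : s ^ 2 = 5/8 := Real.sq_sqrt (by norm_num)
  have s0 : 0 < s := Real.sqrt_pos.mpr (by norm_num)
  clear_value t s
  set w : ℂ := ⟨t, s⟩ with hw
  have hwn : ‖w‖ = 1 := by
    have : ‖w‖ ^ 2 = 1 := by
      rw [← Complex.normSq_eq_norm_sq, Complex.normSq_apply]; simp [hw]; linarith
    exact (pow_eq_one_iff_of_nonneg (norm_nonneg _) (by norm_num)).mp this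
  set v : ℂ := (starRingEnd ℂ) w with hv
  have hvn : ‖v‖ = 1 := by rw [hv, RCLike.norm_conj, hwn]
  have hwv : w * v = 1 := by
    rw [hv, Complex.mul_conj, Complex.normSq_eq_norm_sq, hwn]; simp
  have hadd : w + v = 2 * t := by rw [hv, Complex.add_conj]; simp [hw]
  have hsub : w - v = 2 * s * Complex.I := by rw [hv, Complex.sub_conj]; simp [hw]
  have hden : ∀ z : ℂ, 1 - 2 * t * z + z ^ 2 = (1 - w * z) * (1 - v * z) := by
    intro z
    rw [← hadd]; linear_combination (-z ^ 2) * hwv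
  have hsc : (s : ℂ) ≠ 0 := by exact_mod_cast s0.ne'
  refine ⟨fun z => z / (1 - 2 * t * z + z ^ 2), fun n => (w ^ n).im / s, ⟨?_, ?_, ?_, ?_, ?_⟩, ?_⟩
  · intro z hz
    apply DifferentiableAt.differentiableWithinAt
    apply DifferentiableAt.div (by fun_prop) (by fun_prop)
    rw [hden]
    exact mul_ne_zero (aux_ne w z hwn hz) (aux_ne v z hvn hz)
  · simp
  · simp [hw, s0.ne']
  · intro z hz
    have hz' : ‖z‖ < 1 := by simpa using hz
    have g1 := hasSum_geometric_of_norm_lt_one (ξ := w * z) (by rw [norm_mul, hwn, one_mul]; exact hz')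
    have g2 := hasSum_geometric_of_norm_lt_one (ξ := v * z) (by rw [norm_mul, hvn, one_mul]; exact hz')
    have g := (g1.sub g2).mul_left (1 / (2 * s * Complex.I))
    refine aux_hs g (fun n => ?_) ?_
    · have : w ^ n - v ^ n = 2 * ((w ^ n).im : ℂ) * Complex.I := by
        rw [hv, ← map_pow, Complex.sub_conj]; push_cast; ring
      rw [mul_pow, mul_pow, ← sub_mul, this]
      push_cast
      field_simp
    · have n1 := aux_ne w z hwn hz
      have n2 := aux_ne v z hvn hz
      simp only [hden]
      have : (1 - w * z)⁻¹ - (1 - v * z)⁻¹ = (2 * s * Complex.I) * z / ((1 - w * z) * (1 - v * z)) := by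
        rw [← hsub, inv_sub_inv n1 n2]; congr 1; ring
      rw [this]
      have := Complex.I_ne_zero
      field_simp
  · intro z hz
    exact aux_quad t z hz
  · have e2 : (w ^ 2).im / s = 2 * t := by
      rw [pow_two, Complex.mul_im]; simp only [hw]; field_simp; ring
    have e3 : (w ^ 3).im / s = 1 / 2 := by
      have : (w ^ 3).im = s * (3 * t ^ 2 - s ^ 2) := by
        rw [pow_succ, pow_two, Complex.mul_im, Complex.mul_im, Complex.mul_re]; simp only [hw]; ring
      rw [this, t2, s2]; field_simp; norm_num
    simp only [e2, e3]
    linarith [mul_pow 2 t 2]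

lemma aux_lower : ∃ (f : ℂ → ℂ) (a : ℕ → ℝ), IsTypicallyReal f a ∧
      a 2 ^ 2 - a 3 ^ 2 = -9 := by
  refine ⟨fun z => (1/2 : ℝ) * (z / (1 - 2 * (1:ℝ) * z + z ^ 2) + z / (1 - 2 * (-1:ℝ) * z + z ^ 2)),
    fun n => (1/2) * (n - n * (-1) ^ n), ⟨?_, ?_, ?_, ?_, ?_⟩, ?_⟩
  · intro z hz
    apply DifferentiableAt.differentiableWithinAt
    have n1 := aux_ne 1 z (by simp) hz
    have n2 := aux_ne (-1) z (by simp) hz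
    have m1 : 1 - 2 * ((1:ℝ):ℂ) * z + z ^ 2 ≠ 0 := by
      convert pow_ne_zero 2 n1 using 1; push_cast; ring
    have m2 : 1 - 2 * ((-1:ℝ):ℂ) * z + z ^ 2 ≠ 0 := by
      convert pow_ne_zero 2 n2 using 1; push_cast; ring
    have d1 : DifferentiableAt ℂ (fun z : ℂ => z / (1 - 2 * ((1:ℝ):ℂ) * z + z ^ 2)) z :=
      DifferentiableAt.fun_div (by fun_prop) (by fun_prop) m1
    have d2 : DifferentiableAt ℂ (fun z : ℂ => z / (1 - 2 * ((-1:ℝ):ℂ) * z + z ^ 2)) z :=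
      DifferentiableAt.fun_div (by fun_prop) (by fun_prop) m2
    exact (d1.fun_add d2).const_mul _
  · simp
  · norm_num
  · intro z hz
    have hz' : ‖z‖ < 1 := by simpa using hz
    have g1 := hasSum_coe_mul_geometric_of_norm_lt_one (r := z) hz'
    have g2 := hasSum_coe_mul_geometric_of_norm_lt_one (r := -z) (by rwa [norm_neg])
    have g := (g1.sub g2).mul_left (1/2)
    refine aux_hs g (fun n => ?_) ?_
    · rw [neg_pow z]
      push_cast
      ring
    · have e1 : 1 - 2 * ((1:ℝ):ℂ) * z + z ^ 2 = (1 - z) ^ 2 := by push_cast; ring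
      have e2 : 1 - 2 * ((-1:ℝ):ℂ) * z + z ^ 2 = (1 - -z) ^ 2 := by push_cast; ring
      simp only [e1, e2]
      push_cast
      ring
  · intro z hz
    have h1 := aux_quad 1 z hz
    have h2 := aux_quad (-1) z hz
    simp only [Complex.im_ofReal_mul, Complex.add_im]
    nlinarith
  · norm_num

theorem stmt_15 :
    (∀ (f : ℂ → ℂ) (a : ℕ → ℝ), IsTypicallyReal f a →
      -9 ≤ a 2 ^ 2 - a 3 ^ 2 ∧ a 2 ^ 2 - a 3 ^ 2 ≤ 5 / 4) ∧
    (∃ (f : ℂ → ℂ) (a : ℕ → ℝ), IsTypicallyReal f a ∧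
      a 2 ^ 2 - a 3 ^ 2 = 5 / 4) ∧
    (∃ (f : ℂ → ℂ) (a : ℕ → ℝ), IsTypicallyReal f a ∧
      a 2 ^ 2 - a 3 ^ 2 = -9) := by
  refine ⟨fun f a hf => ?_, aux_upper, aux_lower⟩
  obtain ⟨h1, h2⟩ := aux_bounds f a hf
  constructor
  · nlinarith [sq_nonneg (a 2)]
  · nlinarith [sq_nonneg (a 3 - 1 / 2)]
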